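/- Let k : ℝ³ → ℝ be infinitely differentiable with compact support and define the Newtonian potential V(r) = (1/(4π)) ∫_{ℝ³} k(r') / ‖r − r'‖ dr'. Then V is twice continuously differentiable and satisfies the Poisson equation ΔV(r) = −k(r) for all r ∈ ℝ³. -/

import Mathlib

open MeasureTheory Real
open scoped RealInnerProductSpace

noncomputable section

/-- Euclidean space ℝ³. -/
abbrev E3 := EuclideanSpace ℝ (Fin 3)

/-- Laplacian of a scalar field: sum of second partial derivatives. -/
def lap (u : E3 → ℝ) (x : E3) : ℝ :=
  ∑ i : Fin 3,
    fderiv ℝ (fun y => fderiv ℝ u y (EuclideanSpace.single i 1)) x (EuclideanSpace.single i 1)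

/-- Divergence of a vector field: sum of partial derivatives of its components. -/
def dvg (v : E3 → E3) (x : E3) : ℝ :=
  ∑ i : Fin 3, fderiv ℝ v x (EuclideanSpace.single i 1) i

open Filter Topology Set
open scoped ContDiff Convolution

/-- The `i`-th partial derivative of a scalar field. -/
def partialDeriv (i : Fin 3) (u : E3 → ℝ) (x : E3) : ℝ :=
  fderiv ℝ u x (EuclideanSpace.single i 1)

lemma lap_eq_sum_partialDeriv (u : E3 → ℝ) (x : E3) :
    lap u x = ∑ i, partialDeriv i (partialDeriv i u) x := rfl

lemma ContDiff.partialDeriv {m n : WithTop ℕ∞} {u : E3 → ℝ} (hu : ContDiff ℝ n u)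
    (hmn : m + 1 ≤ n) (i : Fin 3) : ContDiff ℝ m (partialDeriv i u) :=
  (hu.fderiv_right hmn).clm_apply contDiff_const

lemma HasCompactSupport.partialDeriv {u : E3 → ℝ} (hu : HasCompactSupport u) (i : Fin 3) :
    HasCompactSupport (partialDeriv i u) :=
  hu.fderiv_apply ℝ _

lemma ContDiff.continuous_lap {u : E3 → ℝ} (hu : ContDiff ℝ 2 u) : Continuous (lap u) :=
  continuous_finsetSum _ fun i _ =>
    ((hu.partialDeriv (m := 1) (by norm_num) i).partialDeriv (m := 0) (by norm_num) i).continuous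

lemma HasCompactSupport.lap {u : E3 → ℝ} (hu : HasCompactSupport u) :
    HasCompactSupport (lap u) := by
  have h (i : Fin 3) := (hu.partialDeriv i).partialDeriv i
  convert! ((h 0).add (h 1)).add (h 2) using 1
  ext x
  simp [lap_eq_sum_partialDeriv, Fin.sum_univ_three]

lemma integral_mul_partialDeriv {g f : E3 → ℝ} (hg : ContDiff ℝ 1 g) (hf : ContDiff ℝ 1 f)
    (hfc : HasCompactSupport f) (i : Fin 3) :
    ∫ x, g x * partialDeriv i f x = -∫ x, partialDeriv i g x * f x := by
  have hg' : Continuous (partialDeriv i g) := (hg.partialDeriv (m := 0) (by norm_num) i).continuous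
  have hf' : Continuous (partialDeriv i f) := (hf.partialDeriv (m := 0) (by norm_num) i).continuous
  exact integral_mul_fderiv_eq_neg_fderiv_mul_of_integrable
    ((hg'.mul hf.continuous).integrable_of_hasCompactSupport hfc.mul_left)
    ((hg.continuous.mul hf').integrable_of_hasCompactSupport (hfc.partialDeriv i).mul_left)
    ((hg.continuous.mul hf.continuous).integrable_of_hasCompactSupport hfc.mul_left)
    (fun x _ => hg.differentiable (by norm_num) x) (fun x _ => hf.differentiable (by norm_num) x)

/-- Green's second identity for a compactly supported function. -/
lemma integral_mul_lap {g f : E3 → ℝ} (hg : ContDiff ℝ 2 g) (hf : ContDiff ℝ 2 f)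
    (hfc : HasCompactSupport f) : ∫ x, g x * lap f x = ∫ x, lap g x * f x := by
  have hg1 i : ContDiff ℝ 1 (partialDeriv i g) := hg.partialDeriv (by norm_num) i
  have hf1 i : ContDiff ℝ 1 (partialDeriv i f) := hf.partialDeriv (by norm_num) i
  have hg2 i : Continuous (partialDeriv i (partialDeriv i g)) :=
    ((hg1 i).partialDeriv (m := 0) (by norm_num) i).continuous
  have hf2 i : Continuous (partialDeriv i (partialDeriv i f)) :=
    ((hf1 i).partialDeriv (m := 0) (by norm_num) i).continuous
  simp_rw [lap_eq_sum_partialDeriv, Finset.mul_sum, Finset.sum_mul]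
  rw [integral_finsetSum, integral_finsetSum]
  · refine Finset.sum_congr rfl fun i _ => ?_
    rw [integral_mul_partialDeriv (hg.of_le (by norm_num)) (hf1 i) (hfc.partialDeriv i),
      integral_mul_partialDeriv (hg1 i) (hf.of_le (by norm_num)) hfc, neg_neg]
  · exact fun i _ => ((hg2 i).mul hf.continuous).integrable_of_hasCompactSupport hfc.mul_left
  · exact fun i _ => (hg.continuous.mul (hf2 i)).integrable_of_hasCompactSupport
      ((hfc.partialDeriv i).partialDeriv i).mul_left

lemma contDiff_norm_sq_add_rpow {c : ℝ} (hc : 0 < c) (p : ℝ) {n : WithTop ℕ∞} :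
    ContDiff ℝ n fun y : E3 => (‖y‖ ^ 2 + c) ^ p :=
  ((contDiff_norm_sq ℝ).add contDiff_const).rpow_const_of_ne fun y => by positivity

lemma partialDeriv_norm_sq_add_rpow {c : ℝ} (hc : 0 < c) (p : ℝ) (i : Fin 3) (y : E3) :
    partialDeriv i (fun y => (‖y‖ ^ 2 + c) ^ p) y = 2 * p * (y i * (‖y‖ ^ 2 + c) ^ (p - 1)) := by
  have h : HasFDerivAt (fun y : E3 => ‖y‖ ^ 2 + c) (2 • innerSL ℝ y) y :=
    (hasStrictFDerivAt_norm_sq y).hasFDerivAt.add_const c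
  have h' := h.rpow_const (p := p) (Or.inl (by positivity))
  rw [partialDeriv, h'.fderiv]
  simp [EuclideanSpace.inner_single_right]
  ring

lemma lap_norm_sq_add_rpow {c : ℝ} (hc : 0 < c) (y : E3) :
    lap (fun y => (‖y‖ ^ 2 + c) ^ (-1 / 2 : ℝ)) y = -(3 * c * (‖y‖ ^ 2 + c) ^ (-5 / 2 : ℝ)) := by
  have hpos : 0 < ‖y‖ ^ 2 + c := by positivity
  have hsecond (i : Fin 3) :
      partialDeriv i (partialDeriv i fun y => (‖y‖ ^ 2 + c) ^ (-1 / 2 : ℝ)) y =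
        -(‖y‖ ^ 2 + c) ^ (-3 / 2 : ℝ) + 3 * y i ^ 2 * (‖y‖ ^ 2 + c) ^ (-5 / 2 : ℝ) := by
    have hfst : partialDeriv i (fun y : E3 => (‖y‖ ^ 2 + c) ^ (-1 / 2 : ℝ)) =
        fun y => -(y i * (‖y‖ ^ 2 + c) ^ (-3 / 2 : ℝ)) := by
      ext z
      rw [partialDeriv_norm_sq_add_rpow hc]
      norm_num
    have hcoord : HasFDerivAt (fun y : E3 => y i) (EuclideanSpace.proj i : E3 →L[ℝ] ℝ) y :=
      (EuclideanSpace.proj i : E3 →L[ℝ] ℝ).hasFDerivAt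
    have hpow := ((contDiff_norm_sq_add_rpow (n := 1) hc (-3 / 2)).differentiable
      (by norm_num) y).hasFDerivAt
    have hp := partialDeriv_norm_sq_add_rpow hc (-3 / 2) i y
    rw [partialDeriv] at hp
    have hprod := (hcoord.fun_mul hpow).fun_neg
    rw [hfst, partialDeriv, hprod.fderiv]
    simp only [neg_apply, add_apply,
      smul_apply, hp, smul_eq_mul, PiLp.proj_apply, PiLp.single_apply]
    norm_num
    ring
  have hnorm : ‖y‖ ^ 2 = ∑ i, y i ^ 2 := EuclideanSpace.real_norm_sq_eq y
  have hexp : (‖y‖ ^ 2 + c) ^ (-3 / 2 : ℝ) =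
      (‖y‖ ^ 2 + c) * (‖y‖ ^ 2 + c) ^ (-5 / 2 : ℝ) := by
    rw [← Real.rpow_one_add' hpos.le (by norm_num)]
    norm_num
  rw [lap_eq_sum_partialDeriv]
  simp_rw [hsecond]
  rw [Finset.sum_add_distrib, ← Finset.sum_mul, ← Finset.mul_sum, ← hnorm, hexp]
  simp
  ring

lemma integral_Ioi_sq_mul_sq_add_one_rpow :
    ∫ y in Ioi (0 : ℝ), y ^ 2 * (y ^ 2 + 1) ^ (-5 / 2 : ℝ) = 1 / 3 := by
  have hderiv (y : ℝ) : HasDerivAt (fun y : ℝ => y ^ 3 / 3 * (y ^ 2 + 1) ^ (-3 / 2 : ℝ))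
      (y ^ 2 * (y ^ 2 + 1) ^ (-5 / 2 : ℝ)) y := by
    have hpos : 0 < y ^ 2 + 1 := by positivity
    have h1 : HasDerivAt (fun y : ℝ => y ^ 3 / 3) (y ^ 2) y := by
      convert! (hasDerivAt_pow 3 y).div_const 3 using 1
      norm_num
    have h2 : HasDerivAt (fun y : ℝ => y ^ 2 + 1) (2 * y) y := by
      convert! (hasDerivAt_pow 2 y).add_const 1 using 1
      norm_num
    have h3 := h1.mul (h2.rpow_const (p := -3 / 2) (Or.inl hpos.ne'))
    convert! h3 using 1
    have hexp : (y ^ 2 + 1) ^ (-3 / 2 : ℝ) = (y ^ 2 + 1) * (y ^ 2 + 1) ^ (-5 / 2 : ℝ) := by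
      rw [← Real.rpow_one_add' hpos.le (by norm_num)]
      norm_num
    rw [hexp]
    norm_num
    ring
  have hlim : Tendsto (fun y : ℝ => y ^ 3 / 3 * (y ^ 2 + 1) ^ (-3 / 2 : ℝ)) atTop
      (𝓝 (1 / 3)) := by
    have hden : Tendsto (fun y : ℝ => y ^ 2 + 1) atTop atTop :=
      tendsto_atTop_add_const_right _ _ (tendsto_pow_atTop (by norm_num))
    have h1 : Tendsto (fun y : ℝ => (1 - (y ^ 2 + 1)⁻¹) ^ (3 / 2 : ℝ) / 3) atTop
        (𝓝 ((1 - 0) ^ (3 / 2 : ℝ) / 3)) :=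
      ((tendsto_const_nhds.sub hden.inv_tendsto_atTop).rpow_const (by norm_num)).div_const 3
    rw [sub_zero, Real.one_rpow] at h1
    refine h1.congr' ?_
    filter_upwards [eventually_gt_atTop 0] with y hy
    have hpos : 0 < y ^ 2 + 1 := by positivity
    have hfrac : 1 - (y ^ 2 + 1)⁻¹ = y ^ 2 * (y ^ 2 + 1)⁻¹ := by field_simp; ring
    rw [hfrac, Real.mul_rpow (by positivity) (by positivity), Real.inv_rpow hpos.le,
      ← Real.rpow_neg hpos.le, ← Real.rpow_natCast y 2, ← Real.rpow_mul hy.le]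
    norm_num
    ring
  have h := integral_Ioi_of_hasDerivAt_of_nonneg' (a := (0 : ℝ)) (fun y _ => hderiv y)
    (fun y _ => by positivity) hlim
  simpa using h

lemma integral_norm_sq_add_one_rpow :
    ∫ y : E3, (‖y‖ ^ 2 + 1) ^ (-5 / 2 : ℝ) = 4 * π / 3 := by
  have hvol : (volume : Measure E3).real (Metric.ball 0 1) = π * 4 / 3 := by
    rw [measureReal_def, EuclideanSpace.volume_ball_fin_three]
    simp [ENNReal.toReal_ofReal, show (0 : ℝ) ≤ π * 4 / 3 by positivity]
  rw [integral_fun_norm_addHaar volume fun t : ℝ => (t ^ 2 + 1) ^ (-5 / 2 : ℝ), hvol]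
  simp only [finrank_euclideanSpace, Fintype.card_fin, smul_eq_mul, nsmul_eq_mul,
    Nat.add_one_sub_one, integral_Ioi_sq_mul_sq_add_one_rpow]
  norm_num
  ring

lemma locallyIntegrable_norm_inv : LocallyIntegrable fun y : E3 => ‖y‖⁻¹ := by
  rw [locallyIntegrable_iff]
  intro K hK
  obtain ⟨R, hR⟩ := hK.isBounded.subset_ball 0
  refine IntegrableOn.mono_set ?_ hR
  rw [integrableOn_fun_norm_addHaar volume (f := fun t : ℝ => t⁻¹)]
  have hid : IntegrableOn (fun t : ℝ => t) (Ioo 0 R) :=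
    continuous_id.integrableOn_Icc.mono_set Ioo_subset_Icc_self
  refine hid.congr_fun (fun t ht => ?_) measurableSet_Ioo
  have := ht.1.ne'
  simp [pow_two, this]

/-- The rescaled kernels `ε² (‖y‖² + ε²)^(-5/2)` form an approximate identity of mass `4π/3`. -/
lemma tendsto_integral_approxIdentity {f : E3 → ℝ} (hf : Continuous f)
    (hfc : HasCompactSupport f) :
    Tendsto (fun ε : ℝ => ∫ y : E3, ε ^ 2 * (‖y‖ ^ 2 + ε ^ 2) ^ (-5 / 2 : ℝ) * f y) (𝓝[>] 0)
      (𝓝 (4 * π / 3 * f 0)) := by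
  have hscale (ε : ℝ) (hε : 0 < ε) :
      ∫ y : E3, ε ^ 2 * (‖y‖ ^ 2 + ε ^ 2) ^ (-5 / 2 : ℝ) * f y =
        ∫ z : E3, (‖z‖ ^ 2 + 1) ^ (-5 / 2 : ℝ) * f (ε • z) := by
    have h := Measure.integral_comp_smul (volume : Measure E3)
      (fun y => ε ^ 2 * (‖y‖ ^ 2 + ε ^ 2) ^ (-5 / 2 : ℝ) * f y) ε
    simp only [finrank_euclideanSpace, Fintype.card_fin, smul_eq_mul, abs_inv, abs_pow,
      abs_of_pos hε] at h
    rw [eq_comm, inv_mul_eq_iff_eq_mul₀ (by positivity)] at h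
    rw [h, ← integral_const_mul]
    refine integral_congr_ae (.of_forall fun z => ?_)
    have hpow : (‖ε • z‖ ^ 2 + ε ^ 2) ^ (-5 / 2 : ℝ) =
        (ε ^ 5)⁻¹ * (‖z‖ ^ 2 + 1) ^ (-5 / 2 : ℝ) := by
      rw [norm_smul, Real.norm_of_nonneg hε.le, mul_pow, ← mul_add_one,
        Real.mul_rpow (by positivity) (by positivity), ← Real.rpow_natCast ε 2,
        ← Real.rpow_mul hε.le, ← Real.rpow_natCast ε 5, ← Real.rpow_neg hε.le]
      norm_num
    simp only [hpow]
    field_simp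
  obtain ⟨C, hC⟩ := hf.bounded_above_of_compact_support hfc
  have hint : Integrable fun z : E3 => (‖z‖ ^ 2 + 1) ^ (-5 / 2 : ℝ) := by
    have h := integrable_rpow_neg_one_add_norm_sq (E := E3) (μ := volume) (r := 5)
      (by simp; norm_num)
    simpa only [add_comm] using h
  have hcont : Continuous fun z : E3 => (‖z‖ ^ 2 + 1) ^ (-5 / 2 : ℝ) :=
    (contDiff_norm_sq_add_rpow (n := 0) one_pos _).continuous
  rw [← integral_norm_sq_add_one_rpow, ← integral_mul_const]
  refine Tendsto.congr' (f₁ := fun ε : ℝ =>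
    ∫ z : E3, (‖z‖ ^ 2 + 1) ^ (-5 / 2 : ℝ) * f (ε • z)) ?_ ?_
  · filter_upwards [self_mem_nhdsWithin] with ε hε using (hscale ε hε).symm
  refine tendsto_integral_filter_of_dominated_convergence
    (fun z => (‖z‖ ^ 2 + 1) ^ (-5 / 2 : ℝ) * C) ?_ ?_ (hint.mul_const C) ?_
  · exact .of_forall fun ε => (hcont.mul (by fun_prop)).aestronglyMeasurable
  · refine .of_forall fun ε => .of_forall fun z => ?_
    rw [norm_mul, Real.norm_of_nonneg (by positivity)]
    gcongr
    exact hC _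
  · refine .of_forall fun z => ?_
    have h : Continuous fun ε : ℝ => (‖z‖ ^ 2 + 1) ^ (-5 / 2 : ℝ) * f (ε • z) := by fun_prop
    simpa using (h.tendsto 0).mono_left nhdsWithin_le_nhds

lemma tendsto_integral_norm_sq_add_rpow_mul {g : E3 → ℝ} (hg : Continuous g)
    (hgc : HasCompactSupport g) :
    Tendsto (fun ε : ℝ => ∫ y : E3, (‖y‖ ^ 2 + ε ^ 2) ^ (-1 / 2 : ℝ) * g y) (𝓝[>] 0)
      (𝓝 (∫ y : E3, ‖y‖⁻¹ * g y)) := by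
  have hnonzero : ∀ᵐ y : E3, y ≠ 0 := by simp [ae_iff]
  have hsq {y : E3} : (‖y‖ ^ 2) ^ (-1 / 2 : ℝ) = ‖y‖⁻¹ := by
    rw [← Real.rpow_natCast, ← Real.rpow_mul (norm_nonneg y), ← Real.rpow_neg_one]
    norm_num
  refine tendsto_integral_filter_of_dominated_convergence (fun y => ‖y‖⁻¹ * ‖g y‖) ?_ ?_ ?_ ?_
  · filter_upwards [self_mem_nhdsWithin] with ε hε
    have hε2 : 0 < ε ^ 2 := pow_pos hε 2
    exact ((contDiff_norm_sq_add_rpow (n := 0) hε2 _).continuous.mul hg).aestronglyMeasurable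
  · refine .of_forall fun ε => ?_
    filter_upwards [hnonzero] with y hy
    rw [norm_mul, Real.norm_of_nonneg (by positivity), ← hsq]
    have : 0 < ‖y‖ := norm_pos_iff.2 hy
    gcongr ?_ * _
    exact Real.rpow_le_rpow_of_nonpos (by positivity) (by simp [sq_nonneg]) (by norm_num)
  · exact locallyIntegrable_norm_inv.integrable_smul_right_of_hasCompactSupport hg.norm hgc.norm
  · filter_upwards [hnonzero] with y hy
    have hpos : 0 < ‖y‖ := norm_pos_iff.2 hy
    have hadd : Tendsto (fun ε : ℝ => ‖y‖ ^ 2 + ε ^ 2) (𝓝[>] 0) (𝓝 (‖y‖ ^ 2)) := by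
      have h : Continuous fun ε : ℝ => ‖y‖ ^ 2 + ε ^ 2 := by fun_prop
      simpa using (h.tendsto 0).mono_left nhdsWithin_le_nhds
    rw [← hsq]
    exact (hadd.rpow_const (Or.inl (by positivity))).mul_const _

/-- `-1 / (4π‖y‖)` is a fundamental solution of the Laplacian on `ℝ³`. -/
lemma integral_norm_inv_mul_lap {f : E3 → ℝ} (hf : ContDiff ℝ 2 f) (hfc : HasCompactSupport f) :
    ∫ y : E3, ‖y‖⁻¹ * lap f y = -(4 * π * f 0) := by
  have h1 := tendsto_integral_norm_sq_add_rpow_mul hf.continuous_lap hfc.lap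
  have h2 := (tendsto_integral_approxIdentity hf.continuous hfc).const_mul (-3)
  have heq : -3 * (4 * π / 3 * f 0) = -(4 * π * f 0) := by ring
  rw [heq] at h2
  refine tendsto_nhds_unique (h1.congr' ?_) h2
  filter_upwards [self_mem_nhdsWithin] with ε hε
  have hε2 : 0 < ε ^ 2 := pow_pos hε 2
  rw [integral_mul_lap (contDiff_norm_sq_add_rpow hε2 _) hf hfc, ← integral_const_mul]
  refine integral_congr_ae (.of_forall fun y => ?_)
  simp only [lap_norm_sq_add_rpow hε2]
  ring

lemma partialDeriv_comp_const_sub (f : E3 → ℝ) (r : E3) (i : Fin 3) (y : E3) :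
    partialDeriv i (fun y => f (r - y)) y = -partialDeriv i f (r - y) := by
  have h := (ContinuousLinearEquiv.neg ℝ (M := E3)).comp_right_fderiv
    (f := fun z => f (r + z)) (x := y)
  rw [fderiv_comp_add_left] at h
  simp only [Function.comp_def, ContinuousLinearEquiv.neg_apply, ← sub_eq_add_neg] at h
  simp [partialDeriv, h]

lemma lap_comp_const_sub (f : E3 → ℝ) (r y : E3) :
    lap (fun y => f (r - y)) y = lap f (r - y) := by
  simp_rw [lap_eq_sum_partialDeriv]
  refine Finset.sum_congr rfl fun i _ => ?_
  have h : partialDeriv i (fun y => f (r - y)) = -fun y => partialDeriv i f (r - y) :=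
    funext (partialDeriv_comp_const_sub f r i)
  rw [h, partialDeriv, fderiv_neg, neg_apply, ← partialDeriv,
    partialDeriv_comp_const_sub, neg_neg]

lemma partialDeriv_convolution {g f : E3 → ℝ} (hg : LocallyIntegrable g) (hf : ContDiff ℝ 1 f)
    (hfc : HasCompactSupport f) (i : Fin 3) :
    partialDeriv i (g ⋆[ContinuousLinearMap.mul ℝ ℝ] f) =
      g ⋆[ContinuousLinearMap.mul ℝ ℝ] partialDeriv i f := by
  ext x
  rw [partialDeriv, (hfc.hasFDerivAt_convolution_right _ hg hf x).fderiv,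
    convolution_precompR_apply _ hg (hfc.fderiv ℝ) (hf.continuous_fderiv (by norm_num))]
  rfl

lemma lap_convolution {g f : E3 → ℝ} (hg : LocallyIntegrable g) (hf : ContDiff ℝ 2 f)
    (hfc : HasCompactSupport f) (x : E3) :
    lap (g ⋆[ContinuousLinearMap.mul ℝ ℝ] f) x = ∫ t, g t * lap f (x - t) := by
  have hf1 i : ContDiff ℝ 1 (partialDeriv i f) := hf.partialDeriv (by norm_num) i
  have hf2 i : Continuous (partialDeriv i (partialDeriv i f)) :=
    ((hf1 i).partialDeriv (m := 0) (by norm_num) i).continuous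
  simp_rw [lap_eq_sum_partialDeriv, Finset.mul_sum]
  rw [integral_finsetSum]
  · refine Finset.sum_congr rfl fun i _ => ?_
    rw [partialDeriv_convolution hg (hf.of_le (by norm_num)) hfc,
      partialDeriv_convolution hg (hf1 i) (hfc.partialDeriv i)]
    rfl
  · exact fun i _ => ((hfc.partialDeriv i).partialDeriv i).convolutionExists_right
      (ContinuousLinearMap.mul ℝ ℝ) hg (hf2 i) x

/-- the Newtonian potential V(r) = (1/4π)∫ k(r')/‖r−r'‖ dr' of a smooth
compactly supported k is C² and solves the Poisson equation ΔV = −k. -/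
theorem newtonian_potential_poisson (k : E3 → ℝ)
    (hk : ContDiff ℝ (⊤ : ℕ∞) k) (hk_supp : HasCompactSupport k)
    (V : E3 → ℝ)
    (hV : ∀ r : E3, V r = (1 / (4 * π)) * ∫ r' : E3, k r' / ‖r - r'‖) :
    ContDiff ℝ 2 V ∧ ∀ r : E3, lap V r = -k r := by
  have hk2 : ContDiff ℝ 2 k := hk.of_le (by exact WithTop.coe_le_coe.2 le_top)
  have hk4 : ContDiff ℝ 2 fun x => (1 / (4 * π)) * k x := contDiff_const.mul hk2
  have hk4c : HasCompactSupport fun x => (1 / (4 * π)) * k x := hk_supp.mul_left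
  have hVconv : V = (fun y : E3 => ‖y‖⁻¹) ⋆[ContinuousLinearMap.mul ℝ ℝ]
      fun x => (1 / (4 * π)) * k x := by
    ext r
    rw [hV, convolution_mul_swap, ← integral_const_mul]
    refine integral_congr_ae (.of_forall fun y => ?_)
    simp only [div_eq_mul_inv]
    ring
  rw [hVconv]
  refine ⟨hk4c.contDiff_convolution_right (n := 2) _ locallyIntegrable_norm_inv hk4, fun r => ?_⟩
  rw [lap_convolution locallyIntegrable_norm_inv hk4 hk4c]
  have hshift : ContDiff ℝ 2 fun y => (1 / (4 * π)) * k (r - y) :=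
    hk4.comp (contDiff_const.sub contDiff_id)
  have hshiftc : HasCompactSupport fun y => (1 / (4 * π)) * k (r - y) :=
    hk4c.comp_homeomorph (Homeomorph.subLeft r)
  have h := integral_norm_inv_mul_lap hshift hshiftc
  simp_rw [lap_comp_const_sub (fun x => (1 / (4 * π)) * k x) r] at h
  rw [h, sub_zero]
  field_simp

end
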